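/- arXiv:2402.01882 — 2 statements merged into one kernel-verified Lean document; each statement's English description precedes it below -/
import Mathlib

section
/- Let G and H be groups, g₀,...,gₙ ∈ G, and h ∈ H with h ≠ 1. Let a denote the nontrivial element of ℤ/2ℤ. Then g₀·a·g₁·a·...·a·gₙ = 1 in the free product G * (ℤ/2ℤ) if and only if g₀·h⁻¹·g₁·h·g₂·h⁻¹·...·h^((-1)ⁿ)·gₙ = 1 in the free product G * H. -/
open Monoid

namespace Alt

/-- Alternating product `g x g₁ x⁻¹ g₂ x ⋯`. -/
def alt {G K : Type} [Group G] [Group K] : K → G → List G → Coprod G K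
  | _, g, [] => Coprod.inl g
  | x, g, g' :: l => Coprod.inl g * (Coprod.inr x * alt x⁻¹ g' l)

/-- Every entry except the last is nontrivial. -/
def Red {G : Type} [Group G] : List G → Prop
  | [] => True
  | [_] => True
  | g :: g' :: l => g ≠ 1 ∧ Red (g' :: l)

lemma Red.tail {G : Type} [Group G] {g : G} {l : List G} (h : Red (g :: l)) : Red l := by
  cases l with
  | nil => trivial
  | cons a l => exact h.2

lemma inl_mul_alt {G K : Type} [Group G] [Group K] (x : K) (g g' : G) (l : List G) :
    Coprod.inl g * alt x g' l = alt x (g * g') l := by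
  cases l <;> simp [alt, mul_assoc]

lemma exists_red {G : Type} [Group G] (l : List G) (g : G) :
    ∃ (g' : G) (l' : List G), Red l' ∧
      ∀ (K : Type) [Group K] (x : K), alt x g l = alt x g' l' := by
  induction l generalizing g with
  | nil => exact ⟨g, [], trivial, fun _ _ _ => rfl⟩
  | cons a l ih =>
    obtain ⟨k, m, hm, h⟩ := ih a
    cases m with
    | nil => exact ⟨g, [k], trivial, fun K _ x => by rw [alt, h]; rfl⟩
    | cons m0 ms =>
      by_cases hk : k = 1
      · refine ⟨g * m0, ms, hm.tail, fun K _ x => ?_⟩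
        rw [alt, h, alt, hk, ← inl_mul_alt, map_one, one_mul, ← mul_assoc (Coprod.inr x), ← map_mul,
          mul_inv_cancel, map_one, one_mul, inv_inv]
      · exact ⟨g, k :: m0 :: ms, ⟨hk, hm⟩, fun K _ x => by rw [alt, h]; rfl⟩

/-- The two-element family of groups. -/
abbrev Fam (G K : Type) : Bool → Type
  | true => G
  | false => K

instance famGroup (G K : Type) [Group G] [Group K] : ∀ b, Group (Fam G K b)
  | true => inferInstanceAs (Group G)
  | false => inferInstanceAs (Group K)

/-- Comparison map to the indexed coproduct. -/
def phi (G K : Type) [Group G] [Group K] : Coprod G K →* CoprodI (Fam G K) :=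
  Coprod.lift (CoprodI.of (M := Fam G K) (i := true)) (CoprodI.of (M := Fam G K) (i := false))

lemma phi_inl {G K : Type} [Group G] [Group K] (g : G) :
    phi G K (Coprod.inl g) = CoprodI.of (M := Fam G K) (i := true) g := rfl

lemma phi_inr {G K : Type} [Group G] [Group K] (g : K) :
    phi G K (Coprod.inr g) = CoprodI.of (M := Fam G K) (i := false) g := rfl

open CoprodI in
lemma exists_cons {G K : Type} [Group G] [Group K] (i : Bool) (m : Fam G K i)
    (w : Word (Fam G K)) (hw : w.fstIdx ≠ some i) (h1 : m ≠ 1) :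
    ∃ w' : Word (Fam G K), w'.fstIdx = some i ∧ w'.prod = CoprodI.of m * w.prod :=
  ⟨Word.cons m w hw h1, Word.fstIdx_cons .., Word.prod_cons ..⟩

open CoprodI in
lemma exists_single {G K : Type} [Group G] [Group K] (g : G) :
    ∃ w : Word (Fam G K), w.fstIdx ≠ some false ∧ w.prod = phi G K (Coprod.inl g) := by
  have h0 : ∀ i, (Word.empty : Word (Fam G K)).fstIdx ≠ some i := fun i h => by
    simp [Word.fstIdx, Word.empty] at h
  by_cases hg : g = 1
  · exact ⟨Word.empty, h0 _, by rw [hg, map_one, map_one, Word.prod_empty]⟩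
  · obtain ⟨w, hw, hp⟩ := exists_cons (G := G) (K := K) true g Word.empty (h0 _) hg
    exact ⟨w, by rw [hw]; simp, by rw [hp, Word.prod_empty, mul_one, phi_inl]⟩

open CoprodI in
lemma exists_word {G K : Type} [Group G] [Group K] (l : List G) (g : G) (hl : Red (g :: l))
    (x : K) (hx : x ≠ 1) :
    ∃ w : Word (Fam G K), w.fstIdx = some false ∧
      w.prod = phi G K (Coprod.inr x * alt x⁻¹ g l) := by
  induction l generalizing g x with
  | nil =>
    obtain ⟨w, hw, hp⟩ := exists_single (K := K) g
    obtain ⟨w', hw', hp'⟩ := exists_cons (G := G) (K := K) false x w hw hx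
    exact ⟨w', hw', by rw [hp', hp, alt, map_mul, phi_inr]⟩
  | cons a l ih =>
    obtain ⟨w, hw, hp⟩ := ih a hl.2 x⁻¹ (inv_ne_one.2 hx)
    obtain ⟨v, hv, hq⟩ := exists_cons (G := G) (K := K) true g w (by rw [hw]; simp) hl.1
    obtain ⟨w', hw', hp'⟩ := exists_cons (G := G) (K := K) false x v (by rw [hv]; simp) hx
    exact ⟨w', hw', by rw [hp', hq, hp, alt, map_mul _ _ (_ * _), map_mul _ (Coprod.inl g),
      phi_inr, phi_inl]⟩

open CoprodI in
lemma prod_inj {G K : Type} [Group G] [Group K] {w w' : Word (Fam G K)}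
    (h : w.prod = w'.prod) : w = w' := by
  classical
  exact (Word.equiv (M := Fam G K)).symm.injective h

open CoprodI in
lemma alt_eq_one_iff {G K : Type} [Group G] [Group K] (l : List G) (g : G) (hl : Red l)
    (x : K) (hx : x ≠ 1) : alt x g l = 1 ↔ (g = 1 ∧ l = []) := by
  cases l with
  | nil =>
    simp only [alt, and_true]
    exact map_eq_one_iff _ Coprod.inl_injective
  | cons a l =>
    simp only [reduceCtorEq, and_false, iff_false]
    intro h
    obtain ⟨w, hw, hp⟩ := exists_word l a hl x hx
    obtain ⟨v, hv, hq⟩ := exists_single (K := K) g⁻¹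
    have h2 : w = v := prod_inj (by
      rw [hp, hq, map_inv (Coprod.inl : G →* Coprod G K)]
      congr 1
      exact eq_inv_of_mul_eq_one_right h)
    exact hv (h2 ▸ hw)

lemma ofFn_eq {G K : Type} [Group G] [Group K] (n : ℕ) (g : Fin (n + 1) → G) (c : ℕ → K)
    (hc : ∀ i, c (i + 1) = (c i)⁻¹) :
    Coprod.inl (g 0) * (List.ofFn fun i : Fin n =>
      (Coprod.inr (c i) * Coprod.inl (g i.succ) : Coprod G K)).prod
      = alt (c 0) (g 0) (List.ofFn fun i : Fin n => g i.succ) := by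
  induction n generalizing c with
  | zero => simp [alt]
  | succ n ih =>
    have := ih (fun i => g i.succ) (fun i => c (i + 1)) (fun i => hc _)
    rw [List.ofFn_succ, List.ofFn_succ, List.prod_cons, alt, ← hc]
    simp only [Fin.val_zero, Fin.val_succ]
    simp only [zero_add] at this
    erw [← this]
    simp only [mul_assoc]

end Alt

/-- For groups `G`, `H`, elements `g₀, …, gₙ` of `G` and `1 ≠ h ∈ H`, and `a` the nontrivial
element of `ℤ/2ℤ`: `g₀·a·g₁·a⋯a·gₙ = 1` in `G ∗ ℤ/2ℤ` iff
`g₀·h⁻¹·g₁·h·g₂·h⁻¹⋯h^((-1)ⁿ)·gₙ = 1` in `G ∗ H`, where the occurrence of `h` between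
`g_{i-1}` and `g_i` carries exponent `(-1)^i`. -/
theorem stmt1 {G H : Type} [Group G] [Group H] (n : ℕ) (g : Fin (n + 1) → G)
    (h : H) (hh : h ≠ 1) :
    (Coprod.inl (g 0) *
        (List.ofFn fun i : Fin n =>
          Coprod.inr (Multiplicative.ofAdd (1 : ZMod 2)) * Coprod.inl (g i.succ)).prod
      = (1 : Coprod G (Multiplicative (ZMod 2)))) ↔
    (Coprod.inl (g 0) *
        (List.ofFn fun i : Fin n =>
          Coprod.inr (h ^ ((-1 : ℤ) ^ ((i : ℕ) + 1))) * Coprod.inl (g i.succ)).prod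
      = (1 : Coprod G H)) := by
  rw [Alt.ofFn_eq n g (fun _ => Multiplicative.ofAdd (1 : ZMod 2)) (fun _ => by decide),
    Alt.ofFn_eq n g (fun i => h ^ ((-1 : ℤ) ^ (i + 1)))
      (fun i => by rw [pow_succ _ (i + 1), mul_neg_one, zpow_neg])]
  obtain ⟨g', l', hr, he⟩ := Alt.exists_red (List.ofFn fun i : Fin n => g i.succ) (g 0)
  rw [he, he, Alt.alt_eq_one_iff _ _ hr _ (by decide),
    Alt.alt_eq_one_iff _ _ hr _ (by simpa using hh)]
end

section
/- If A and B are ceers, neither of which is universal, then the product ceer A × B is not universal. -/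
/-- A predicate on a primcodable type is computably enumerable (c.e.). -/
def CePred {α : Type} [Primcodable α] (p : α → Prop) : Prop :=
  Partrec fun a => Part.assert (p a) fun _ => Part.some ()

/-- The `e`-th c.e. set `W_e`, i.e. the domain of the `e`-th partial computable function. -/
def WSet (e : ℕ) : Set ℕ :=
  {n | ((Denumerable.ofNat Nat.Partrec.Code e).eval n).Dom}

/-- A ceer: a computably enumerable equivalence relation on ℕ. -/
def Ceer (E : ℕ → ℕ → Prop) : Prop :=
  Equivalence E ∧ CePred fun p : ℕ × ℕ => E p.1 p.2

/-- Computable reducibility of binary relations (on coded types). -/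
def Reduction {α β : Type} [Primcodable α] [Primcodable β]
    (E : α → α → Prop) (R : β → β → Prop) : Prop :=
  ∃ f : α → β, Computable f ∧ ∀ a b, E a b ↔ R (f a) (f b)

/-- A relation is universal if every ceer computably reduces to it. -/
def Universal {β : Type} [Primcodable β] (R : β → β → Prop) : Prop :=
  ∀ E : ℕ → ℕ → Prop, Ceer E → Reduction E R

/-- The word problem of a group `G` with respect to a coding `ν` of words. -/
def WP {α G : Type} (ν : α → G) : α → α → Prop := fun a b => ν a = ν b


/-- The product of two ceers, via the pairing function on ℕ. -/
def prodRel (A B : ℕ → ℕ → Prop) : ℕ → ℕ → Prop := fun m n =>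
  A (Nat.unpair m).1 (Nat.unpair n).1 ∧ B (Nat.unpair m).2 (Nat.unpair n).2

open Nat.Partrec (Code) in
theorem ce_stage {R : ℕ → ℕ → Prop} (h : CePred fun p : ℕ × ℕ => R p.1 p.2) :
    ∃ c : Code, ∀ i j, R i j ↔ ∃ s, (Code.evaln s c (Nat.pair i j)).isSome = true := by
  have h1 : Partrec fun n : ℕ => (Part.assert (R n.unpair.1 n.unpair.2) fun _ => Part.some (0:ℕ)) := by
    have h2 := (Partrec.comp h Computable.unpair).map (f := _) (g := fun _ _ => (0:ℕ))
      (Computable.const 0).to₂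
    refine h2.of_eq fun n => ?_
    ext x
    simp [Part.mem_assert_iff, eq_comm]
  obtain ⟨c, hc⟩ := Code.exists_code.1 (Partrec.nat_iff.1 h1)
  refine ⟨c, fun i j => ?_⟩
  have h3 : (Code.eval c (Nat.pair i j)).Dom ↔ R i j := by
    rw [hc]
    simp [Part.assert]
  rw [← h3, Part.dom_iff_mem]
  simp only [Code.evaln_complete, Option.isSome_iff_exists]
  exact exists_comm

theorem ce_of_stage {R : ℕ → ℕ → Prop} (S : ℕ → ℕ × ℕ → Bool)
    (hS : Computable₂ S) (h : ∀ i j, R i j ↔ ∃ s, S s (i, j) = true) :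
    CePred fun p : ℕ × ℕ => R p.1 p.2 := by
  have h1 : Partrec fun p : ℕ × ℕ => Nat.rfind fun n => Part.some (S n p) :=
    Partrec.rfind (hS.comp Computable.snd Computable.fst).to₂.partrec₂
  refine (Partrec.dom_re h1).of_eq fun p => ?_
  rw [h p.1 p.2]
  refine Nat.rfind_dom.trans ⟨?_, ?_⟩
  · rintro ⟨n, hn, _⟩
    exact ⟨n, by simpa using hn⟩
  · rintro ⟨n, hn⟩
    exact ⟨n, by simpa using hn.symm, fun _ => trivial⟩

theorem mem_rfindOpt_min {f : ℕ → Option ℕ} {n a : ℕ} (h : f n = some a)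
    (hm : ∀ m < n, f m = none) : a ∈ Nat.rfindOpt f := by
  unfold Nat.rfindOpt
  rw [Part.mem_bind_iff]
  refine ⟨n, ?_, by simp [h]⟩
  refine Nat.mem_rfind.2 ⟨by simp [h], fun {m} hmn => by simp [hm m hmn]⟩

open Nat.Partrec (Code) in
/-- one step of the universal function -/
def uStep (x v : ℕ) : Prop :=
  v ∈ (Denumerable.ofNat Code x.unpair.1).eval x.unpair.2

def uRel : ℕ → ℕ → Prop := Relation.Join (Relation.ReflTransGen uStep)

theorem uRel_equiv : Equivalence uRel := by
  apply Relation.equivalence_join_reflTransGen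
  intro a b c hb hc
  have := Part.mem_unique hb hc
  subst this
  exact ⟨b, .refl, .refl⟩

open Nat.Partrec (Code) in
def uIter (k n x : ℕ) : Option ℕ :=
  Nat.rec (some x) (fun _ o => o.bind fun y =>
    Code.evaln k (Denumerable.ofNat Code y.unpair.1) y.unpair.2) n

open Nat.Partrec (Code) in
theorem uIter_succ (k n x : ℕ) : uIter k (n+1) x = (uIter k n x).bind fun y =>
    Code.evaln k (Denumerable.ofNat Code y.unpair.1) y.unpair.2 := rfl

theorem uIter_mono {k k' n x v : ℕ} (hk : k ≤ k') (h : uIter k n x = some v) :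
    uIter k' n x = some v := by
  induction n generalizing v with
  | zero => exact h
  | succ n ih =>
    rw [uIter_succ, Option.bind_eq_some_iff] at h ⊢
    obtain ⟨y, h1, h2⟩ := h
    exact ⟨y, ih h1, Nat.Partrec.Code.evaln_mono hk h2⟩

theorem uIter_iff {x v : ℕ} : Relation.ReflTransGen uStep x v ↔ ∃ k n, uIter k n x = some v := by
  constructor
  · intro h
    induction h with
    | refl => exact ⟨0, 0, rfl⟩
    | tail _ hs ih =>
      obtain ⟨k, n, h1⟩ := ih
      obtain ⟨k', h2⟩ := Nat.Partrec.Code.evaln_complete.1 hs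
      refine ⟨max k k', n+1, ?_⟩
      rw [uIter_succ, uIter_mono (le_max_left _ _) h1]
      exact Nat.Partrec.Code.evaln_mono (le_max_right _ _) h2
  · rintro ⟨k, n, h⟩
    induction n generalizing v with
    | zero => cases h; exact .refl
    | succ n ih =>
      rw [uIter_succ, Option.bind_eq_some_iff] at h
      obtain ⟨y, h1, h2⟩ := h
      exact (ih h1).tail (Nat.Partrec.Code.evaln_sound h2)

open Nat.Partrec (Code) in
theorem uIter_primrec : Primrec fun p : (ℕ × ℕ) × ℕ => uIter p.1.1 p.1.2 p.2 := by
  refine Primrec.nat_rec' (f := fun p : (ℕ × ℕ) × ℕ => p.1.2) (g := fun p => some p.2)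
    (h := fun p q => q.2.bind fun y =>
      Code.evaln p.1.1 (Denumerable.ofNat Code y.unpair.1) y.unpair.2)
    (Primrec.snd.comp Primrec.fst) (Primrec.option_some.comp Primrec.snd) ?_
  refine Primrec.option_bind (Primrec.snd.comp Primrec.snd) ?_
  refine Code.primrec_evaln.comp (Primrec.pair (Primrec.pair ?_ ?_) ?_)
  · exact Primrec.fst.comp (Primrec.fst.comp (Primrec.fst.comp Primrec.fst))
  · exact (Primrec.ofNat Code).comp (Primrec.fst.comp (Primrec.unpair.comp Primrec.snd))
  · exact Primrec.snd.comp (Primrec.unpair.comp Primrec.snd)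

theorem uRel_ceer : Ceer uRel := by
  refine ⟨uRel_equiv, ?_⟩
  let l : ℕ × (ℕ × ℕ) → Option ℕ := fun p =>
    uIter p.1.unpair.1.unpair.1 p.1.unpair.1.unpair.2 p.2.1
  let r : ℕ × (ℕ × ℕ) → Option ℕ := fun p =>
    uIter p.1.unpair.2.unpair.1 p.1.unpair.2.unpair.2 p.2.2
  have hu : Primrec fun p : ℕ × (ℕ × ℕ) => p.1.unpair := Primrec.unpair.comp Primrec.fst
  have hu1 := Primrec.unpair.comp (Primrec.fst.comp hu)
  have hu2 := Primrec.unpair.comp (Primrec.snd.comp hu)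
  have hl : Primrec l := uIter_primrec.comp (hu1.pair (Primrec.fst.comp Primrec.snd))
  have hr : Primrec r := uIter_primrec.comp (hu2.pair (Primrec.snd.comp Primrec.snd))
  refine ce_of_stage (fun s p => if l (s, p) = r (s, p) then (l (s, p)).isSome else false) ?_ ?_
  · exact (Primrec.ite (Primrec.eq.comp hl hr) (Primrec.option_isSome.comp hl)
      (Primrec.const false)).to_comp
  · intro i j
    simp only [uRel, Relation.Join, uIter_iff, l, r, Bool.if_false_right, Bool.and_eq_true,
      decide_eq_true_eq]
    constructor
    · rintro ⟨v, ⟨k, n, h⟩, k', n', h'⟩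
      exact ⟨Nat.pair (Nat.pair k n) (Nat.pair k' n'), by simp [h, h']⟩
    · rintro ⟨s, h2, h1⟩
      obtain ⟨v, hv⟩ := Option.isSome_iff_exists.1 h1
      exact ⟨v, ⟨_, _, hv⟩, ⟨_, _, h2 ▸ hv⟩⟩

open Nat.Partrec (Code) in
theorem uRel_nontrivial : ∃ a b, ¬ uRel a b := by
  obtain ⟨c, hc⟩ := Code.exists_code.1 Nat.Partrec.none
  have key : ∀ i v, Relation.ReflTransGen uStep (Nat.pair (Encodable.encode c) i) v →
      v = Nat.pair (Encodable.encode c) i := by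
    intro i v h
    rcases Relation.ReflTransGen.cases_head h with h | ⟨w, h, _⟩
    · exact h.symm
    · simp [uStep, hc] at h
  refine ⟨Nat.pair (Encodable.encode c) 0, Nat.pair (Encodable.encode c) 1, ?_⟩
  rintro ⟨v, h1, h2⟩
  have := (key _ _ h1).symm.trans (key _ _ h2)
  simp [Nat.pair_eq_pair] at this

open Nat.Partrec (Code) in
/-- For a c.e. equivalence relation `R`, a partial computable function sending each
non-minimal `i` to a smaller equivalent number. -/
theorem exists_down {R : ℕ → ℕ → Prop} (h : CePred fun p : ℕ × ℕ => R p.1 p.2) :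
    ∃ c : Code, (∀ i j, j ∈ c.eval i → j < i ∧ R i j) ∧
      ∀ i j, j < i → R i j → (c.eval i).Dom := by
  obtain ⟨d, hd⟩ := ce_stage h
  let g : ℕ → ℕ → Option ℕ := fun i n =>
    if n.unpair.1 < i ∧ (Code.evaln n.unpair.2 d (Nat.pair i n.unpair.1)).isSome = true
    then some n.unpair.1 else none
  have hn1 : Primrec fun p : ℕ × ℕ => p.2.unpair.1 :=
    Primrec.fst.comp (Primrec.unpair.comp Primrec.snd)
  have hn2 : Primrec fun p : ℕ × ℕ => p.2.unpair.2 :=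
    Primrec.snd.comp (Primrec.unpair.comp Primrec.snd)
  have hg : Primrec₂ g := by
    refine Primrec.ite (PrimrecPred.and (Primrec.nat_lt.comp hn1 Primrec.fst) ?_)
      (Primrec.option_some.comp hn1) (Primrec.const none)
    refine Primrec.eq.comp (Primrec.option_isSome.comp (Code.primrec_evaln.comp
      ((hn2.pair (Primrec.const d)).pair (Primrec₂.natPair.comp Primrec.fst hn1))))
      (Primrec.const true)
  obtain ⟨c, hc⟩ := Code.exists_code.1 (Partrec.nat_iff.1 (Partrec.rfindOpt hg.to_comp))
  refine ⟨c, ?_, ?_⟩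
  · intro i j hj
    rw [hc] at hj
    obtain ⟨n, hn⟩ := Nat.rfindOpt_spec hj
    simp only [g, Option.mem_def, Option.ite_none_right_eq_some, Option.some.injEq] at hn
    obtain ⟨⟨h1, h2⟩, rfl⟩ := hn
    exact ⟨h1, (hd _ _).2 ⟨_, h2⟩⟩
  · intro i j hj hR
    obtain ⟨s, hs⟩ := (hd _ _).1 hR
    rw [hc]
    refine Nat.rfindOpt_dom.2 ⟨Nat.pair j s, j, ?_⟩
    simp [g, hj, hs]

open Nat.Partrec (Code) in
theorem universal_of_quotient {E : ℕ → ℕ → Prop} (hE : Ceer E)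
    (hU : ∀ x y, uRel x y → E x y) (a b : ℕ) (hab : ¬ E a b) : Universal E := by
  intro R hR
  obtain ⟨cE, hcE⟩ := ce_stage hE.2
  obtain ⟨p, hp1, hp2⟩ := exists_down hR.2
  let f : Code → ℕ → ℕ := fun c i => Nat.pair (Encodable.encode c) i
  have hf : Primrec₂ f := Primrec₂.natPair.comp (Primrec.encode.comp Primrec.fst) Primrec.snd
  -- the bad event `n = ⟨s, ⟨i, j⟩⟩`
  let bad : Code → ℕ → Prop := fun c n =>
    n.unpair.2.unpair.1 ≠ n.unpair.2.unpair.2 ∧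
    Code.evaln n p n.unpair.2.unpair.1 = none ∧
    Code.evaln n p n.unpair.2.unpair.2 = none ∧
    (Code.evaln n.unpair.1 cE
      (Nat.pair (f c n.unpair.2.unpair.1) (f c n.unpair.2.unpair.2))).isSome = true
  have hbd : ∀ c n, Decidable (bad c n) := fun c n => by
    simp only [bad]; infer_instance
  let g : Code × ℕ → ℕ → Option ℕ := fun q n =>
    if Code.evaln n p q.2 = none then
      if bad q.1 n then
        if q.2 = n.unpair.2.unpair.1 then some a
        else if q.2 = n.unpair.2.unpair.2 then some b else none
      else none
    else (Code.evaln n p q.2).map (f q.1)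
  have hc : Primrec fun z : (Code × ℕ) × ℕ => z.1.1 := Primrec.fst.comp Primrec.fst
  have hi : Primrec fun z : (Code × ℕ) × ℕ => z.1.2 := Primrec.snd.comp Primrec.fst
  have hn : Primrec fun z : (Code × ℕ) × ℕ => z.2 := Primrec.snd
  have hs : Primrec fun z : (Code × ℕ) × ℕ => z.2.unpair.1 :=
    Primrec.fst.comp (Primrec.unpair.comp hn)
  have hij : Primrec fun z : (Code × ℕ) × ℕ => z.2.unpair.2.unpair :=
    Primrec.unpair.comp (Primrec.snd.comp (Primrec.unpair.comp hn))
  have hi0 := Primrec.fst.comp hij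
  have hj0 := Primrec.snd.comp hij
  have hev : ∀ {u : (Code × ℕ) × ℕ → ℕ}, Primrec u →
      Primrec fun z : (Code × ℕ) × ℕ => Code.evaln z.2 p (u z) := fun hu =>
    Code.primrec_evaln.comp ((hn.pair (Primrec.const p)).pair hu)
  have hg : Primrec₂ g := by
    refine Primrec.ite (Primrec.eq.comp (hev hi) (Primrec.const none)) ?_ ?_
    · refine Primrec.ite ?_ ?_ (Primrec.const none)
      · refine PrimrecPred.and (PrimrecPred.not (Primrec.eq.comp hi0 hj0)) ?_
        refine PrimrecPred.and (Primrec.eq.comp (hev hi0) (Primrec.const none)) ?_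
        refine PrimrecPred.and (Primrec.eq.comp (hev hj0) (Primrec.const none)) ?_
        refine Primrec.eq.comp (Primrec.option_isSome.comp (Code.primrec_evaln.comp
          ((hs.pair (Primrec.const cE)).pair
            (Primrec₂.natPair.comp (hf.comp hc hi0) (hf.comp hc hj0))))) (Primrec.const true)
      · exact Primrec.ite (Primrec.eq.comp hi hi0) (Primrec.const _)
          (Primrec.ite (Primrec.eq.comp hi hj0) (Primrec.const _) (Primrec.const _))
    · exact Primrec.option_map (hev hi) (hf.comp (hc.comp Primrec.fst) Primrec.snd).to₂
  obtain ⟨c, hcfix⟩ := Code.fixed_point₂ (f := fun c i => Nat.rfindOpt (g (c, i)))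
    (Partrec.rfindOpt hg.to_comp)
  have hstep : ∀ i v, v ∈ Nat.rfindOpt (g (c, i)) → E (f c i) v := by
    intro i v hv
    refine hU _ _ ⟨v, .single ?_, .refl⟩
    simpa [uStep, f, hcfix] using hv
  -- no bad event happens
  have nobad : ∀ n, ¬ bad c n := by
    intro n
    induction n using Nat.strong_induction_on with
    | _ n ih =>
    intro hb
    have hnone : ∀ i, Code.evaln n p i = none → ∀ m < n, g (c, i) m = none := by
      intro i hi m hm
      have h1 : Code.evaln m p i = none := by
        rcases h : Code.evaln m p i with _ | v
        · rfl
        · have := Code.evaln_mono hm.le h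
          rw [hi] at this
          cases this
      simp [g, h1, ih m hm]
    obtain ⟨hne, h1, h2, h3⟩ := id hb
    have ha : E (f c n.unpair.2.unpair.1) a :=
      hstep _ _ (mem_rfindOpt_min (n := n) (by simp [g, h1, hb]) (hnone _ h1))
    have hb' : E (f c n.unpair.2.unpair.2) b :=
      hstep _ _ (mem_rfindOpt_min (n := n) (by simp [g, h2, hb, hne.symm]) (hnone _ h2))
    have hE0 := (hcE _ _).2 ⟨_, h3⟩
    exact hab (hE.1.trans (hE.1.symm ha) (hE.1.trans hE0 hb'))
  have hdown : ∀ i j, j ∈ p.eval i → E (f c i) (f c j) := by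
    intro i j hj
    obtain ⟨k, hk⟩ := Code.evaln_complete.1 hj
    have hd : (Nat.rfindOpt (g (c, i))).Dom := by
      refine Nat.rfindOpt_dom.2 ⟨k, f c j, ?_⟩
      rw [Option.mem_def] at hk
      simp [g, hk]
    obtain ⟨v, hv⟩ := Part.dom_iff_mem.1 hd
    have hv' := hstep _ _ hv
    obtain ⟨m, hm⟩ := Nat.rfindOpt_spec hv
    rcases h : Code.evaln m p i with _ | w
    · simp [g, h, nobad] at hm
    · simp [g, h] at hm
      have := Part.mem_unique hj (Code.evaln_sound h)
      subst this
      rwa [hm]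
  -- each `i` has a canonical representative
  have hrep : ∀ i, ∃ r, R i r ∧ E (f c i) (f c r) ∧ ∀ j < r, ¬ R r j := by
    intro i
    induction i using Nat.strong_induction_on with
    | _ i ih =>
    by_cases h : ∃ j < i, R i j
    · obtain ⟨j, hj, hRj⟩ := h
      obtain ⟨w, hw⟩ := Part.dom_iff_mem.1 (hp2 i j hj hRj)
      obtain ⟨hwi, hRw⟩ := hp1 _ _ hw
      obtain ⟨r, h1, h2, h3⟩ := ih w hwi
      exact ⟨r, hR.1.trans hRw h1, hE.1.trans (hdown _ _ hw) h2, h3⟩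
    · push Not at h
      exact ⟨i, hR.1.refl i, hE.1.refl _, h⟩
  refine ⟨f c, (hf.comp (Primrec.const c) Primrec.id).to_comp, fun i j => ?_⟩
  obtain ⟨r, hr1, hr2, hr3⟩ := hrep i
  obtain ⟨t, ht1, ht2, ht3⟩ := hrep j
  have hpn : ∀ r, (∀ j < r, ¬ R r j) → ∀ n, Code.evaln n p r = none := by
    intro r hr n
    rcases h : Code.evaln n p r with _ | v
    · rfl
    · obtain ⟨h1, h2⟩ := hp1 _ _ (Code.evaln_sound h)
      exact absurd h2 (hr _ h1)
  constructor
  · intro hij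
    have hrt : R r t := hR.1.trans (hR.1.symm hr1) (hR.1.trans hij ht1)
    have : r = t := by
      rcases lt_trichotomy r t with h | h | h
      · exact absurd (hR.1.symm hrt) (ht3 _ h)
      · exact h
      · exact absurd hrt (hr3 _ h)
    subst this
    exact hE.1.trans hr2 (hE.1.symm ht2)
  · intro hij
    have hrt : E (f c r) (f c t) := hE.1.trans (hE.1.symm hr2) (hE.1.trans hij ht2)
    have : r = t := by
      by_contra hne
      obtain ⟨s, hs⟩ := (hcE _ _).1 hrt
      refine nobad (Nat.pair s (Nat.pair r t)) ?_
      simp only [bad, Nat.unpair_pair]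
      exact ⟨hne, hpn r hr3 _, hpn t ht3 _, hs⟩
    subst this
    exact hR.1.trans hr1 (hR.1.symm ht1)

theorem ceer_pullback {A : ℕ → ℕ → Prop} (hA : Ceer A) {g : ℕ → ℕ} (hg : Computable g) :
    Ceer fun x y => A (g x) (g y) := by
  refine ⟨⟨fun _ => hA.1.refl _, fun h => hA.1.symm h, fun h h' => hA.1.trans h h'⟩, ?_⟩
  exact Partrec.comp hA.2 ((hg.comp Computable.fst).pair (hg.comp Computable.snd))

theorem universal_pullback {A : ℕ → ℕ → Prop} {g : ℕ → ℕ} (hg : Computable g)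
    (h : Universal fun x y => A (g x) (g y)) : Universal A := by
  intro E hE
  obtain ⟨f, hf, hred⟩ := h E hE
  exact ⟨fun x => g (f x), hg.comp hf, hred⟩

/-- If `A` and `B` are ceers, neither of which is universal, then `A × B` is not universal. -/
theorem stmt3 (A B : ℕ → ℕ → Prop) (hA : Ceer A) (hB : Ceer B)
    (hnA : ¬ Universal A) (hnB : ¬ Universal B) :
    ¬ Universal (prodRel A B) := by
  intro h
  obtain ⟨f, hf, hf'⟩ := h uRel uRel_ceer
  have hg1 : Computable fun x => (f x).unpair.1 := Computable.fst.comp (Computable.unpair.comp hf)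
  have hg2 : Computable fun x => (f x).unpair.2 := Computable.snd.comp (Computable.unpair.comp hf)
  obtain ⟨a, b, hab⟩ := uRel_nontrivial
  rw [hf', prodRel, not_and_or] at hab
  rcases hab with hab | hab
  · exact hnA (universal_pullback hg1 (universal_of_quotient (ceer_pullback hA hg1)
      (fun x y hxy => ((hf' x y).1 hxy).1) a b hab))
  · exact hnB (universal_pullback hg2 (universal_of_quotient (ceer_pullback hB hg2)
      (fun x y hxy => ((hf' x y).1 hxy).2) a b hab))
end
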